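/- arXiv:math/0612168 — 2 statements merged into one kernel-verified Lean document; each statement's English description precedes it below -/
import Mathlib

section
/- Let V : ℝ → [0, ∞) be a measurable function and suppose there are real numbers a < b and c > 0 such that V(x) ≥ c for all x ∈ [a, b]. Then there exists a constant C > 0 (depending only on a, b, c) such that for every Schwartz function ψ : ℝ → ℝ, ∫_ℝ ψ(x)²/(1 + x²) dx ≤ C·∫_ℝ (V(x)·ψ(x)² + ψ'(x)²) dx. -/
open MeasureTheory

/-- The Hardy-type weight `φ' - φ²`, where `φ = hardyPotential m ε`. -/
noncomputable def hardyWeight (m ε x : ℝ) : ℝ :=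
  ((x - m) ^ 2 / 4 - ε / 2) / ((x - m) ^ 2 + ε) ^ 2

/-- The regularisation `-t / (2 (t² + ε))`, with `t = x - m`, of the function `-1 / (2 t)` that
yields Hardy's inequality on a half-line. -/
noncomputable def hardyPotential (m ε x : ℝ) : ℝ := -((x - m) / ((x - m) ^ 2 + ε)) / 2

/-- The derivative of `hardyPotential m ε`. -/
noncomputable def hardyPotentialDeriv (m ε x : ℝ) : ℝ :=
  ((x - m) ^ 2 - ε) / (2 * ((x - m) ^ 2 + ε) ^ 2)

lemma hasDerivAt_hardyPotential (m : ℝ) {ε : ℝ} (hε : 0 < ε) (x : ℝ) :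
    HasDerivAt (hardyPotential m ε) (hardyPotentialDeriv m ε x) x := by
  have hpos : (x - m) ^ 2 + ε ≠ 0 := by positivity
  have h1 : HasDerivAt (fun y : ℝ => y - m) 1 x := (hasDerivAt_id x).sub_const m
  have h2 := (((h1.div ((h1.pow 2).add_const ε) hpos).neg).div_const 2)
  refine h2.congr_deriv ?_
  simp only [hardyPotentialDeriv, Pi.pow_apply]
  field_simp
  norm_num
  ring

lemma hardyPotentialDeriv_sub_sq (m : ℝ) {ε : ℝ} (hε : 0 < ε) (x : ℝ) :
    hardyPotentialDeriv m ε x - hardyPotential m ε x ^ 2 = hardyWeight m ε x := by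
  have hpos : (x - m) ^ 2 + ε ≠ 0 := by positivity
  simp only [hardyPotentialDeriv, hardyPotential, hardyWeight]
  field_simp
  ring

lemma continuous_hardyPotential (m : ℝ) {ε : ℝ} (hε : 0 < ε) :
    Continuous (hardyPotential m ε) := by
  unfold hardyPotential
  have : ∀ x : ℝ, (x - m) ^ 2 + ε ≠ 0 := fun x => by positivity
  fun_prop (disch := assumption)

lemma continuous_hardyPotentialDeriv (m : ℝ) {ε : ℝ} (hε : 0 < ε) :
    Continuous (hardyPotentialDeriv m ε) := by
  unfold hardyPotentialDeriv
  have : ∀ x : ℝ, 2 * ((x - m) ^ 2 + ε) ^ 2 ≠ 0 := fun x => by positivity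
  fun_prop (disch := assumption)

lemma norm_hardyPotential_le (m : ℝ) {ε : ℝ} (hε : 0 < ε) (x : ℝ) :
    ‖hardyPotential m ε x‖ ≤ 1 + 1 / ε := by
  have hpos : 0 < (x - m) ^ 2 + ε := by positivity
  rw [hardyPotential, Real.norm_eq_abs, abs_div, abs_neg, abs_div, abs_of_pos hpos, abs_two,
    div_div, div_le_iff₀ (by positivity)]
  have h : (1 + 1 / ε) * (((x - m) ^ 2 + ε) * 2)
      = 2 * (x - m) ^ 2 + 2 * ε + 2 * (x - m) ^ 2 / ε + 2 := by
    field_simp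
    ring
  have h' : 0 ≤ 2 * (x - m) ^ 2 / ε := by positivity
  rw [h]
  nlinarith [sq_nonneg (|x - m| - 1), sq_abs (x - m)]

lemma norm_hardyPotentialDeriv_le (m : ℝ) {ε : ℝ} (hε : 0 < ε) (x : ℝ) :
    ‖hardyPotentialDeriv m ε x‖ ≤ 1 / ε := by
  have hpos : 0 < (x - m) ^ 2 + ε := by positivity
  rw [hardyPotentialDeriv, Real.norm_eq_abs, abs_div, abs_of_pos (show
    0 < 2 * ((x - m) ^ 2 + ε) ^ 2 by positivity), div_le_div_iff₀ (by positivity) hε]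
  have h : |(x - m) ^ 2 - ε| ≤ (x - m) ^ 2 + ε := by
    rw [abs_le]
    constructor <;> nlinarith [sq_nonneg (x - m)]
  nlinarith [sq_nonneg (x - m), mul_le_mul_of_nonneg_right h hε.le]

/-- The weight dominates a multiple of `1 / (1 + x²)` away from its centre. -/
lemma le_hardyWeight {m ε x : ℝ} (hε : 0 < ε) (hx : 4 * ε ≤ (x - m) ^ 2) :
    1 / (25 * (1 + m ^ 2)) * (1 / (1 + x ^ 2)) ≤ hardyWeight m ε x := by
  set s := (x - m) ^ 2 with hs
  have hspos : 0 < s := by linarith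
  have h1 : s ≤ 2 * ((1 + m ^ 2) * (1 + x ^ 2)) := by
    rw [hs]; nlinarith [sq_nonneg (x + m), sq_nonneg (x * m)]
  calc 1 / (25 * (1 + m ^ 2)) * (1 / (1 + x ^ 2))
      = 2 / (25 * (2 * ((1 + m ^ 2) * (1 + x ^ 2)))) := by field_simp
    _ ≤ 2 / (25 * s) := by gcongr
    _ ≤ hardyWeight m ε x := by
      rw [hardyWeight, ← hs, div_le_div_iff₀ (by positivity) (by positivity)]
      nlinarith [mul_nonneg hspos.le (sub_nonneg.2 hx), mul_nonneg hε.le (sub_nonneg.2 hx)]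

lemma neg_le_hardyWeight (m : ℝ) {ε : ℝ} (hε : 0 < ε) (x : ℝ) :
    -(1 / (2 * ε)) ≤ hardyWeight m ε x := by
  have hs := sq_nonneg (x - m)
  rw [hardyWeight, le_div_iff₀ (by positivity)]
  have h : -(1 / (2 * ε)) * ((x - m) ^ 2 + ε) ^ 2
      = -(((x - m) ^ 2) ^ 2 / (2 * ε)) - (x - m) ^ 2 - ε / 2 := by
    field_simp
    ring
  have h' : 0 ≤ ((x - m) ^ 2) ^ 2 / (2 * ε) := by positivity
  rw [h]
  linarith

lemma SchwartzMap.integrable_and_integral_deriv_hardyPotential_mul_sq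
    (ψ : SchwartzMap ℝ ℝ) (m : ℝ) {ε : ℝ} (hε : 0 < ε) :
    Integrable (fun x => hardyPotentialDeriv m ε x * ψ x ^ 2
      + hardyPotential m ε x * (2 * ψ x * deriv ψ x)) ∧
    ∫ x, (hardyPotentialDeriv m ε x * ψ x ^ 2
      + hardyPotential m ε x * (2 * ψ x * deriv ψ x)) = 0 := by
  have hψ : MemLp ψ 2 := ψ.memLp 2
  have hψ' : MemLp (deriv ψ) 2 volume :=
    MemLp.congr_norm ((SchwartzMap.derivCLM ℝ ℝ ψ).memLp 2 volume)
      (by simpa using (measurable_deriv ψ).aestronglyMeasurable) (.of_forall fun x => by simp)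
  have hsq : Integrable (fun x => ψ x ^ 2) := hψ.integrable_sq
  have hmul : Integrable (fun x => 2 * ψ x * deriv ψ x) := by
    simpa only [mul_assoc, Pi.mul_apply] using (hψ.integrable_mul hψ').const_mul 2
  have hf : Integrable (fun x => hardyPotential m ε x * ψ x ^ 2) :=
    hsq.bdd_mul (continuous_hardyPotential m hε).aestronglyMeasurable
      (.of_forall (norm_hardyPotential_le m hε))
  have hg : Integrable (fun x => hardyPotentialDeriv m ε x * ψ x ^ 2
      + hardyPotential m ε x * (2 * ψ x * deriv ψ x)) :=
    (hsq.bdd_mul (continuous_hardyPotentialDeriv m hε).aestronglyMeasurable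
      (.of_forall (norm_hardyPotentialDeriv_le m hε))).add
    (hmul.bdd_mul (continuous_hardyPotential m hε).aestronglyMeasurable
      (.of_forall (norm_hardyPotential_le m hε)))
  refine ⟨hg, integral_eq_zero_of_hasDerivAt_of_integrable (fun x => ?_) hg hf⟩
  have hd : HasDerivAt (fun y => ψ y ^ 2) (2 * ψ x * deriv ψ x) x := by
    have h := (ψ.differentiableAt (x := x)).hasDerivAt.pow 2
    simp only [Nat.cast_ofNat, Nat.add_one_sub_one, pow_one] at h
    exact h
  exact (hasDerivAt_hardyPotential m hε x).mul hd

/-- Let `V : ℝ → [0, ∞)` be a measurable function and suppose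
there are real numbers `a < b` and `c > 0` such that `V(x) ≥ c` for all
`x ∈ [a, b]`.  Then there exists a constant `C > 0` (depending only on `a, b, c`)
such that for every Schwartz function `ψ : ℝ → ℝ`,
`∫_ℝ ψ(x)²/(1 + x²) dx ≤ C·∫_ℝ (V(x)·ψ(x)² + ψ'(x)²) dx`. -/
theorem poincare_with_potential (a b c : ℝ) (hab : a < b) (hc : 0 < c) :
    ∃ C : ℝ, 0 < C ∧
      ∀ V : ℝ → ℝ, Measurable V → (∀ x : ℝ, 0 ≤ V x) →
        (∀ x ∈ Set.Icc a b, c ≤ V x) →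
        ∀ ψ : SchwartzMap ℝ ℝ,
          (∫⁻ x : ℝ, ENNReal.ofReal ((ψ x) ^ 2 / (1 + x ^ 2)))
            ≤ ENNReal.ofReal C *
              ∫⁻ x : ℝ, ENNReal.ofReal (V x * (ψ x) ^ 2 + (deriv ψ x) ^ 2) := by
  obtain ⟨m, hm⟩ : ∃ m, m = (a + b) / 2 := ⟨_, rfl⟩
  obtain ⟨ε, hεdef⟩ : ∃ ε, ε = (b - a) ^ 2 / 16 := ⟨_, rfl⟩
  have hε : 0 < ε := by
    have := sub_pos.2 hab
    rw [hεdef]; positivity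
  obtain ⟨δ, hδdef⟩ : ∃ δ, δ = 1 / (25 * (1 + m ^ 2)) := ⟨_, rfl⟩
  have hδ : 0 < δ := by rw [hδdef]; positivity
  have hδ1 : δ ≤ 1 := by
    rw [hδdef, div_le_one (by positivity)]; nlinarith [sq_nonneg m]
  obtain ⟨M, hMdef⟩ : ∃ M, M = 1 + 1 / (2 * ε) := ⟨_, rfl⟩
  have hM : 0 < M := by rw [hMdef]; positivity
  obtain ⟨K, hKdef⟩ : ∃ K, K = 1 + M / c := ⟨_, rfl⟩
  have hK : 0 < K := by rw [hKdef]; positivity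
  refine ⟨K / δ, by positivity, fun V hVm hV0 hVc ψ => ?_⟩
  have hH0 : ∀ x, 0 ≤ V x * ψ x ^ 2 + deriv ψ x ^ 2 := fun x => by
    have := hV0 x
    positivity
  have hweight : ∀ x, δ * (1 / (1 + x ^ 2)) ≤ hardyWeight m ε x + M / c * V x := fun x => by
    by_cases hx : x ∈ Set.Icc a b
    · have h1 : M ≤ M / c * V x := by
        calc M = M / c * c := by field_simp
          _ ≤ _ := by gcongr; exact hVc x hx
      have h2 : 1 / (1 + x ^ 2) ≤ 1 := by
        rw [div_le_one (by positivity)]; nlinarith [sq_nonneg x]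
      have h3 : δ * (1 / (1 + x ^ 2)) ≤ 1 := mul_le_one₀ hδ1 (by positivity) h2
      linarith [neg_le_hardyWeight m hε x]
    · have h1 : 4 * ε ≤ (x - m) ^ 2 := by
        rw [Set.mem_Icc, not_and_or, not_le, not_le] at hx
        rw [hεdef, hm]
        rcases hx with hx | hx <;> nlinarith
      have h2 : 0 ≤ M / c * V x := mul_nonneg (by positivity) (hV0 x)
      have h3 := le_hardyWeight hε h1
      rw [← hδdef] at h3
      linarith
  obtain ⟨hg, hg0⟩ := ψ.integrable_and_integral_deriv_hardyPotential_mul_sq m hε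
  have hpoint : ∀ x, ψ x ^ 2 / (1 + x ^ 2) ≤ K / δ * (V x * ψ x ^ 2 + deriv ψ x ^ 2)
      + δ⁻¹ * (hardyPotentialDeriv m ε x * ψ x ^ 2
        + hardyPotential m ε x * (2 * ψ x * deriv ψ x)) := fun x => by
    have h1 := mul_le_mul_of_nonneg_right (hweight x) (sq_nonneg (ψ x))
    rw [← hardyPotentialDeriv_sub_sq m hε] at h1
    have h2 := sq_nonneg (deriv ψ x + hardyPotential m ε x * ψ x)
    have h3 : 0 ≤ V x * ψ x ^ 2 := mul_nonneg (hV0 x) (sq_nonneg _)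
    have h4 : 0 ≤ M / c * deriv ψ x ^ 2 := by positivity
    have h5 : δ * (ψ x ^ 2 / (1 + x ^ 2)) ≤ K * (V x * ψ x ^ 2 + deriv ψ x ^ 2)
        + (hardyPotentialDeriv m ε x * ψ x ^ 2
          + hardyPotential m ε x * (2 * ψ x * deriv ψ x)) := by
      have h6 : δ * (ψ x ^ 2 / (1 + x ^ 2)) = δ * (1 / (1 + x ^ 2)) * ψ x ^ 2 := by ring
      rw [h6, hKdef]
      linarith
    rw [← mul_le_mul_iff_right₀ hδ]
    refine h5.trans_eq ?_
    field_simp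
  by_cases htop : ∫⁻ x, ENNReal.ofReal (V x * ψ x ^ 2 + deriv ψ x ^ 2) = ⊤
  · rw [htop, ENNReal.mul_top (by simpa using div_pos hK hδ)]
    exact le_top
  have hHm : Measurable (fun x => V x * ψ x ^ 2 + deriv ψ x ^ 2) :=
    (hVm.mul (ψ.continuous.measurable.pow_const 2)).add ((measurable_deriv ψ).pow_const 2)
  have hH : Integrable (fun x => V x * ψ x ^ 2 + deriv ψ x ^ 2) :=
    (lintegral_ofReal_ne_top_iff_integrable hHm.aestronglyMeasurable (.of_forall hH0)).1 htop
  have hF0 : ∀ x, 0 ≤ ψ x ^ 2 / (1 + x ^ 2) := fun x => by positivity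
  have hF : Integrable (fun x => ψ x ^ 2 / (1 + x ^ 2)) := by
    refine (ψ.memLp 2 : MemLp ψ 2 volume).integrable_sq.mono'
      (Measurable.aestronglyMeasurable ?_) (.of_forall fun x => ?_)
    · exact (ψ.continuous.measurable.pow_const 2).div (by fun_prop)
    · rw [Real.norm_of_nonneg (hF0 x)]
      exact div_le_self (sq_nonneg _) (by nlinarith [sq_nonneg x])
  rw [← ofReal_integral_eq_lintegral_ofReal hF (.of_forall hF0),
    ← ofReal_integral_eq_lintegral_ofReal hH (.of_forall hH0),
    ← ENNReal.ofReal_mul (by positivity)]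
  refine ENNReal.ofReal_le_ofReal
    ((integral_mono hF ((hH.const_mul _).add (hg.const_mul _)) hpoint).trans_eq ?_)
  rw [integral_add' (hH.const_mul _) (hg.const_mul _), integral_const_mul, integral_const_mul, hg0]
  simp
end

section
/- Fix M > 0 and σ > 1. Then there exist b > 0 and C > 0 such that for every l ∈ ℕ (with λ = l(l+1)) and every Schwartz function ψ : ℝ → ℝ the following Morawetz commutator estimate holds: ∫_ℝ 2 g_λ'(x) ψ'(x)² dx + σ b² ψ(x_λ)² − (1/2)∫_ℝ (b³ σ(σ+1)/(1 + b|x − x_λ|)^{σ+2}) ψ(x)² dx − ∫_ℝ g_λ(x)·W_λ'(x)·ψ(x)² dx ≥ C·∫_ℝ ( ψ(x)²/(1 + x²)^{σ/2 + 1} + ψ'(x)²/(1 + x²)^{σ/2} ) dx, where the constants b, C are uniform in l. Here x_λ = r_*(α_λ), α_λ is the unique critical point of V_λ in (2M, ∞), g_λ(x) = ∫_0^{b(x − x_λ)} (1 + |τ|)^{−σ} dτ (so g_λ'(x) = b(1 + b|x − x_λ|)^{−σ}), and W_λ' denotes the derivative of W_λ. -/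
open MeasureTheory

theorem regge_wheeler_hasDerivAt (M L r : ℝ) (hr : 0 < r) :
    HasDerivAt (fun r : ℝ => (1 - 2 * M / r) * (2 * M / r ^ 3 + L / r ^ 2))
      (-(2 / r ^ 5) * (L * r ^ 2 - 3 * M * (L - 1) * r - 8 * M ^ 2)) r := by
  have h0 := hr.ne'
  have hd : HasDerivAt (fun r : ℝ => (1 - 2 * M / r) * (2 * M / r ^ 3 + L / r ^ 2)) _ r :=
    (((hasDerivAt_const r (1 : ℝ)).sub ((hasDerivAt_const r (2 * M)).div (hasDerivAt_id r) h0)).mul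
      (((hasDerivAt_const r (2 * M)).div (hasDerivAt_pow 3 r) (pow_ne_zero 3 h0)).add
        ((hasDerivAt_const r L).div (hasDerivAt_pow 2 r) (pow_ne_zero 2 h0))))
  convert hd using 1
  simp
  field_simp
  ring

theorem critical_radius_bounds {M L a : ℝ} (hM : 0 < M) (hL : 0 ≤ L) (ha : 2 * M < a)
    (hQ : L * a ^ 2 - 3 * M * (L - 1) * a - 8 * M ^ 2 = 0) : 8 * M / 3 ≤ a ∧ a ≤ 3 * M := by
  constructor
  · by_contra! h
    have h0 : 0 < a := by linarith
    have h1 : L * a * (a - 3 * M) ≤ 0 :=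
      mul_nonpos_of_nonneg_of_nonpos (by positivity) (by linarith)
    nlinarith
  · by_contra! h
    have h0 : 0 < a := by linarith
    have h1 : 0 ≤ L * a * (a - 3 * M) := mul_nonneg (by positivity) (by linarith)
    nlinarith

theorem critical_quadratic_factor {M L a r : ℝ} (ha : a ≠ 0)
    (hQ : L * a ^ 2 - 3 * M * (L - 1) * a - 8 * M ^ 2 = 0) :
    L * r ^ 2 - 3 * M * (L - 1) * r - 8 * M ^ 2 = (r - a) * (L * r + 8 * M ^ 2 / a) := by
  field_simp
  linear_combination r * hQ

/-- The tortoise coordinate. -/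
noncomputable def tortoise (M r : ℝ) : ℝ :=
  r + 2 * M * Real.log ((r - 2 * M) / (2 * M)) - 3 * M + 2 * M * Real.log 2

theorem tortoise_sub {M r s : ℝ} (hM : 0 < M) (hs : 2 * M < s) (hr : 2 * M < r) :
    tortoise M r - tortoise M s = (r - s) + 2 * M * Real.log ((r - 2 * M) / (s - 2 * M)) := by
  have h1 : r - 2 * M ≠ 0 := by linarith
  have h2 : s - 2 * M ≠ 0 := by linarith
  have h3 : 2 * M ≠ 0 := by positivity
  unfold tortoise
  rw [Real.log_div h1 h3, Real.log_div h2 h3, Real.log_div h1 h2]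
  ring

theorem sub_le_tortoise_sub {M r s : ℝ} (hM : 0 < M) (hs : 2 * M < s) (hsr : s ≤ r) :
    r - s ≤ tortoise M r - tortoise M s := by
  rw [tortoise_sub hM hs (by linarith)]
  have : 0 ≤ Real.log ((r - 2 * M) / (s - 2 * M)) :=
    Real.log_nonneg ((one_le_div (by linarith)).2 (by linarith))
  have := mul_nonneg hM.le this
  linarith

theorem tortoise_sub_le {M r s : ℝ} (hM : 0 < M) (hs : 8 * M / 3 ≤ s) (hsr : s ≤ r) :
    tortoise M r - tortoise M s ≤ 4 * (r - s) := by
  have hs' : 0 < s - 2 * M := by linarith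
  rw [tortoise_sub hM (by linarith) (by linarith)]
  have h1 := Real.log_le_sub_one_of_pos (x := (r - 2 * M) / (s - 2 * M))
    (div_pos (by linarith) hs')
  have h2 : 2 * M * ((r - 2 * M) / (s - 2 * M) - 1) ≤ 3 * (r - s) := by
    have : (r - 2 * M) / (s - 2 * M) - 1 = (r - s) / (s - 2 * M) := by field_simp; ring
    rw [this, ← mul_div_assoc, div_le_iff₀ hs']
    nlinarith
  have h3 := mul_le_mul_of_nonneg_left h1 (by positivity : (0 : ℝ) ≤ 2 * M)
  linarith

theorem tortoise_hasDerivAt {M r : ℝ} (hM : 0 < M) (hr : 2 * M < r) :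
    HasDerivAt (tortoise M) (1 + 2 * M / (r - 2 * M)) r := by
  have h1 : r - 2 * M ≠ 0 := by linarith
  have h3 : 2 * M ≠ 0 := by positivity
  have := ((((hasDerivAt_id r).add
    (((((hasDerivAt_id r).sub_const (2 * M)).div_const (2 * M)).log
      (div_ne_zero h1 h3)).const_mul (2 * M))).sub_const (3 * M)).add_const (2 * M * Real.log 2))
  have e : (1 : ℝ) + 2 * M * (1 / (2 * M) / ((r - 2 * M) / (2 * M))) = 1 + 2 * M / (r - 2 * M) := by
    field_simp
  rw [← e]
  exact this

section Inverse

variable {M : ℝ} {ρ : ℝ → ℝ}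

theorem lipschitz_of_tortoise_inverse (hM : 0 < M) (hρ1 : ∀ x, 2 * M < ρ x)
    (hρ2 : ∀ x, tortoise M (ρ x) = x) : LipschitzWith 1 ρ := by
  refine LipschitzWith.of_dist_le_mul fun x y => ?_
  rw [NNReal.coe_one, one_mul, Real.dist_eq, Real.dist_eq]
  rcases le_total (ρ x) (ρ y) with h | h
  · have := sub_le_tortoise_sub hM (hρ1 x) h
    rw [hρ2, hρ2] at this
    rw [abs_sub_comm, abs_sub_comm x, abs_of_nonneg (by linarith : 0 ≤ ρ y - ρ x)]
    exact this.trans (le_abs_self _)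
  · have := sub_le_tortoise_sub hM (hρ1 y) h
    rw [hρ2, hρ2] at this
    rw [abs_of_nonneg (by linarith : 0 ≤ ρ x - ρ y)]
    exact this.trans (le_abs_self _)

theorem hasDerivAt_tortoise_inverse (hM : 0 < M) (hρ1 : ∀ x, 2 * M < ρ x)
    (hρ2 : ∀ x, tortoise M (ρ x) = x) (x : ℝ) : HasDerivAt ρ (1 - 2 * M / ρ x) x := by
  have h1 : 0 < ρ x - 2 * M := by linarith [hρ1 x]
  have h2 : 0 < ρ x := by linarith
  have hd := (tortoise_hasDerivAt hM (hρ1 x)).of_local_left_inverse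
    (lipschitz_of_tortoise_inverse hM hρ1 hρ2).continuous.continuousAt
    (by positivity) (Filter.Eventually.of_forall hρ2)
  have e : (1 + 2 * M / (ρ x - 2 * M))⁻¹ = 1 - 2 * M / ρ x := by
    rw [inv_eq_iff_eq_inv, ← mul_eq_one_iff_eq_inv₀ (by
      rw [one_sub_div h2.ne']; positivity)]
    field_simp
    ring
  rwa [e] at hd

theorem le_of_tortoise_le (hM : 0 < M) (hρ1 : ∀ x, 2 * M < ρ x)
    (hρ2 : ∀ x, tortoise M (ρ x) = x) {a x : ℝ} (h : tortoise M a ≤ x) :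
    a ≤ ρ x := by
  by_contra! h'
  have := sub_le_tortoise_sub hM (hρ1 x) h'.le
  rw [hρ2] at this
  linarith

theorem le_of_le_tortoise (hM : 0 < M) (hρ2 : ∀ x, tortoise M (ρ x) = x) {a x : ℝ}
    (ha : 2 * M < a) (h : x ≤ tortoise M a) : ρ x ≤ a := by
  by_contra! h'
  have := sub_le_tortoise_sub hM ha h'.le
  rw [hρ2] at this
  linarith

/-- The derivative of the effective potential in the tortoise coordinate, factored through the
critical radius `a`. -/
theorem hasDerivAt_effective_potential (hM : 0 < M) (hρ1 : ∀ x, 2 * M < ρ x)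
    (hρ2 : ∀ x, tortoise M (ρ x) = x) {L a : ℝ} (ha : a ≠ 0)
    (hQ : L * a ^ 2 - 3 * M * (L - 1) * a - 8 * M ^ 2 = 0) (x : ℝ) :
    HasDerivAt (fun y => (1 - 2 * M / ρ y) * (2 * M / ρ y ^ 3 + L / ρ y ^ 2))
      (-(2 / ρ x ^ 5) * ((ρ x - a) * (L * ρ x + 8 * M ^ 2 / a)) * (1 - 2 * M / ρ x)) x := by
  have h := (regge_wheeler_hasDerivAt M L (ρ x) (by linarith [hρ1 x])).comp x
    (hasDerivAt_tortoise_inverse hM hρ1 hρ2 x)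
  rw [critical_quadratic_factor ha hQ] at h
  exact h

end Inverse

section Weights

variable {σ b : ℝ}

theorem continuous_weight {s : ℝ → ℝ} (hs : Continuous s) (hb : 0 ≤ b) (p : ℝ) :
    Continuous fun x => (1 + b * |s x|) ^ p := by
  refine Continuous.rpow_const (by fun_prop) fun x => Or.inl ?_
  positivity

theorem weight_le_one (hb : 0 ≤ b) {p : ℝ} (hp : p ≤ 0) (x : ℝ) : (1 + b * |x|) ^ p ≤ 1 :=
  Real.rpow_le_one_of_one_le_of_nonpos (by nlinarith [abs_nonneg x]) hp

theorem integrable_weight_mul (hb : 0 ≤ b) {p : ℝ} (hp : p ≤ 0) (a : ℝ) {F : ℝ → ℝ}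
    (hF : Integrable F) : Integrable fun x => (1 + b * |x - a|) ^ p * F x := by
  refine hF.bdd_mul (c := 1)
    (continuous_weight (s := fun x => x - a) (by fun_prop) hb p).aestronglyMeasurable
    (Filter.Eventually.of_forall fun x => ?_)
  rw [Real.norm_of_nonneg (by positivity)]
  exact weight_le_one hb hp _

/-- Weighted Hardy inequality on a half-line, with a boundary term. -/
theorem hardy_half_line (hσ : 0 ≤ σ) (hb : 0 < b) {f f' : ℝ → ℝ}
    (hf : ∀ x, HasDerivAt f (f' x) x) (hf0 : Filter.Tendsto f Filter.atTop (nhds 0))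
    (hff : Integrable fun x => f x ^ 2) (hff' : Integrable fun x => f x * f' x)
    (hf'f' : Integrable fun x => f' x ^ 2) :
    b ^ 3 * (σ * (σ + 2) / 4) * ∫ x in Set.Ioi 0, (1 + b * |x|) ^ (-(σ + 2)) * f x ^ 2
      ≤ (b * ∫ x in Set.Ioi 0, (1 + b * |x|) ^ (-σ) * f' x ^ 2) + σ / 2 * b ^ 2 * f 0 ^ 2 := by
  have i1 : Integrable fun x => (1 + b * |x|) ^ (-(σ + 2)) * f x ^ 2 := by
    simpa using integrable_weight_mul hb.le (p := -(σ + 2)) (by linarith) 0 hff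
  have i2 : Integrable fun x => (1 + b * |x|) ^ (-(σ + 1)) * (f x * f' x) := by
    simpa using integrable_weight_mul hb.le (p := -(σ + 1)) (by linarith) 0 hff'
  have i3 : Integrable fun x => (1 + b * |x|) ^ (-σ) * f' x ^ 2 := by
    simpa using integrable_weight_mul hb.le (p := -σ) (by linarith) 0 hf'f'
  set D : ℝ → ℝ := fun x => 2 * ((1 + b * |x|) ^ (-(σ + 1)) * (f x * f' x))
    - (σ + 1) * b * ((1 + b * |x|) ^ (-(σ + 2)) * f x ^ 2) with hD
  have iD : Integrable D := (i2.const_mul 2).sub (i1.const_mul _)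
  have hc : Continuous f := continuous_iff_continuousAt.2 fun x => (hf x).continuousAt
  have hint : ∫ x in Set.Ioi 0, D x = 0 - (1 + b * |0|) ^ (-(σ + 1)) * f 0 ^ 2 := by
    refine integral_Ioi_of_hasDerivAt_of_tendsto
      (f := fun x => (1 + b * |x|) ^ (-(σ + 1)) * f x ^ 2) ?_ ?_ iD.integrableOn ?_
    · exact ((continuous_weight continuous_id hb.le _).mul (hc.pow 2)).continuousWithinAt
    · intro x (hx : 0 < x)
      have h1 : HasDerivAt (fun y => (1 + b * y) ^ (-(σ + 1)) * f y ^ 2) _ x :=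
        ((((hasDerivAt_id x).const_mul b).const_add 1).rpow_const
          (p := -(σ + 1)) (Or.inl (by simp; positivity))).mul ((hf x).pow 2)
      have h2 := h1.congr_of_eventuallyEq
        (f₁ := fun x => (1 + b * |x|) ^ (-(σ + 1)) * f x ^ 2) (by
        filter_upwards [lt_mem_nhds hx] with y hy
        rw [abs_of_pos hy])
      convert h2 using 1
      simp only [hD, abs_of_pos hx, id]
      rw [show -(σ + 1) - 1 = -(σ + 2) by ring]
      push_cast
      ring
    · refine squeeze_zero (fun x => by positivity) (fun x => ?_)
        (by simpa using hf0.pow 2 : Filter.Tendsto (fun x => f x ^ 2) Filter.atTop (nhds 0))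
      exact mul_le_of_le_one_left (sq_nonneg _) (weight_le_one hb.le (by linarith) _)
  have hmono : 0 ≤ ∫ x in Set.Ioi 0, (b * ((1 + b * |x|) ^ (-σ) * f' x ^ 2)
      - σ / 2 * b ^ 2 * D x
      - b ^ 3 * (σ * (σ + 2) / 4) * ((1 + b * |x|) ^ (-(σ + 2)) * f x ^ 2)) := by
    refine integral_nonneg fun x => ?_
    have ht : 0 < 1 + b * |x| := by positivity
    have e1 : (1 + b * |x|) ^ (-σ) = (1 + b * |x|) ^ (-(σ + 2)) * (1 + b * |x|) ^ 2 := by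
      rw [← Real.rpow_natCast, ← Real.rpow_add ht]; congr 1; push_cast; ring
    have e2 : (1 + b * |x|) ^ (-(σ + 1)) = (1 + b * |x|) ^ (-(σ + 2)) * (1 + b * |x|) := by
      conv_rhs => rw [← Real.rpow_add_one ht.ne']
      congr 1; ring
    have key : 0 ≤ b * (1 + b * |x|) ^ (-(σ + 2))
        * ((1 + b * |x|) * f' x - σ / 2 * b * f x) ^ 2 := by positivity
    simp only [Pi.zero_apply, hD, e1, e2]
    refine key.trans_eq ?_
    ring
  rw [integral_sub, integral_sub, integral_const_mul, integral_const_mul, integral_const_mul,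
    hint] at hmono
  · simp only [abs_zero, mul_zero, add_zero, Real.one_rpow] at hmono
    linarith
  · exact (i3.const_mul _).integrableOn
  · exact (iD.const_mul _).integrableOn
  · exact ((i3.const_mul _).sub (iD.const_mul _)).integrableOn
  · exact (i1.const_mul _).integrableOn

theorem integral_eq_add_half_lines {F : ℝ → ℝ} (hF : Integrable F) (a : ℝ) :
    ∫ x, F x = (∫ x in Set.Ioi 0, F (a + x)) + ∫ x in Set.Ioi 0, F (a - x) := by
  rw [← integral_add_left_eq_self F a]
  have h : Integrable fun x => F (a + x) := hF.comp_add_left a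
  rw [← integral_add_compl (measurableSet_Ioi (a := (0 : ℝ))) h, Set.compl_Ioi]
  congr 1
  have := integral_comp_neg_Ioi 0 fun x => F (a + x)
  simp only [neg_zero] at this
  rw [← this]
  simp [sub_eq_add_neg]

theorem SchwartzMap.hasDerivAt_deriv (ψ : SchwartzMap ℝ ℝ) (x : ℝ) :
    HasDerivAt ψ (deriv ψ x) x := ψ.differentiable.differentiableAt.hasDerivAt

theorem SchwartzMap.integrable_mul_apply (φ ψ : SchwartzMap ℝ ℝ) :
    Integrable fun x => φ x * ψ x :=
  ψ.integrable.bdd_mul φ.continuous.aestronglyMeasurable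
    (Filter.Eventually.of_forall fun x => φ.norm_le_seminorm ℝ x)

theorem SchwartzMap.integrable_sq (ψ : SchwartzMap ℝ ℝ) : Integrable fun x => ψ x ^ 2 := by
  simpa only [sq] using ψ.integrable_mul_apply ψ

theorem SchwartzMap.integrable_mul_deriv (ψ : SchwartzMap ℝ ℝ) :
    Integrable fun x => ψ x * deriv ψ x :=
  ψ.integrable_mul_apply (SchwartzMap.derivCLM ℝ ℝ ψ)

theorem SchwartzMap.integrable_deriv_sq (ψ : SchwartzMap ℝ ℝ) :
    Integrable fun x => deriv ψ x ^ 2 :=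
  (SchwartzMap.derivCLM ℝ ℝ ψ).integrable_sq

theorem SchwartzMap.tendsto_atTop (ψ : SchwartzMap ℝ ℝ) :
    Filter.Tendsto ψ Filter.atTop (nhds 0) :=
  ψ.tendsto_cocompact.mono_left atTop_le_cocompact

theorem SchwartzMap.tendsto_atBot (ψ : SchwartzMap ℝ ℝ) :
    Filter.Tendsto ψ Filter.atBot (nhds 0) :=
  ψ.tendsto_cocompact.mono_left atBot_le_cocompact

/-- Weighted Hardy inequality on the line, with a term at the centre of the weight. -/
theorem hardy_line (hσ : 0 ≤ σ) (hb : 0 < b) (a : ℝ) (ψ : SchwartzMap ℝ ℝ) :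
    b ^ 3 * (σ * (σ + 2) / 4) * ∫ x, (1 + b * |x - a|) ^ (-(σ + 2)) * ψ x ^ 2
      ≤ (b * ∫ x, (1 + b * |x - a|) ^ (-σ) * deriv ψ x ^ 2) + σ * b ^ 2 * ψ a ^ 2 := by
  rw [integral_eq_add_half_lines
      (integrable_weight_mul hb.le (p := -(σ + 2)) (by linarith) a ψ.integrable_sq) a,
    integral_eq_add_half_lines
      (integrable_weight_mul hb.le (p := -σ) (by linarith) a ψ.integrable_deriv_sq) a]
  have h1 := hardy_half_line (f := fun x => ψ (a + x)) (f' := fun x => deriv ψ (a + x)) hσ hb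
    (fun x => (ψ.hasDerivAt_deriv (a + x)).comp_const_add a x)
    (ψ.tendsto_atTop.comp (Filter.tendsto_atTop_add_const_left _ a Filter.tendsto_id))
    (ψ.integrable_sq.comp_add_left a) (ψ.integrable_mul_deriv.comp_add_left a)
    (ψ.integrable_deriv_sq.comp_add_left a)
  have h2 := hardy_half_line (f := fun x => ψ (a - x)) (f' := fun x => -deriv ψ (a - x)) hσ hb
    (fun x => (ψ.hasDerivAt_deriv (a - x)).comp_const_sub a x)
    (ψ.tendsto_atBot.comp
      (Filter.tendsto_atBot_add_const_left _ a Filter.tendsto_neg_atTop_atBot))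
    (ψ.integrable_sq.comp_sub_left a)
    (by simpa using (ψ.integrable_mul_deriv.comp_sub_left a).neg)
    (by simpa using ψ.integrable_deriv_sq.comp_sub_left a)
  simp only [add_sub_cancel_left, sub_sub_cancel_left, abs_neg, neg_sq, add_zero, sub_zero]
    at h1 h2 ⊢
  linarith

theorem sq_sub_le_mul_integral_deriv_sq (ψ : SchwartzMap ℝ ℝ) {x y : ℝ} (hxy : x < y) :
    (ψ y - ψ x) ^ 2 ≤ (y - x) * ∫ t in x..y, deriv ψ t ^ 2 := by
  have i1 : IntervalIntegrable (deriv ψ) volume x y :=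
    (SchwartzMap.derivCLM ℝ ℝ ψ).integrable.intervalIntegrable
  have i2 : IntervalIntegrable (fun t => deriv ψ t ^ 2) volume x y :=
    ψ.integrable_deriv_sq.intervalIntegrable
  have hFTC := intervalIntegral.integral_eq_sub_of_hasDerivAt
    (fun t _ => ψ.hasDerivAt_deriv t) i1
  have h : 0 ≤ ∫ t in x..y, ((y - x) * deriv ψ t ^ 2 - 2 * (ψ y - ψ x) * deriv ψ t
      + (ψ y - ψ x) ^ 2 / (y - x)) := by
    refine intervalIntegral.integral_nonneg hxy.le fun t _ => ?_
    have hp : 0 < y - x := by linarith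
    have : (y - x) * deriv ψ t ^ 2 - 2 * (ψ y - ψ x) * deriv ψ t + (ψ y - ψ x) ^ 2 / (y - x)
        = ((y - x) * deriv ψ t - (ψ y - ψ x)) ^ 2 / (y - x) := by field_simp; ring
    rw [this]
    positivity
  rw [intervalIntegral.integral_add ((i2.const_mul _).sub (i1.const_mul _)) (by simp),
    intervalIntegral.integral_sub (i2.const_mul _) (i1.const_mul _),
    intervalIntegral.integral_const_mul, intervalIntegral.integral_const_mul, hFTC,
    intervalIntegral.integral_const, smul_eq_mul, mul_div_cancel₀ _ (by linarith)] at h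
  linarith

/-- A point value is controlled by the mass on `[a + 1, a + 2]` and the energy on `[a, a + 2]`. -/
theorem sq_apply_le_local (ψ : SchwartzMap ℝ ℝ) (a : ℝ) :
    ψ a ^ 2 ≤ 2 * (∫ x in Set.Ioc (a + 1) (a + 2), ψ x ^ 2)
      + 4 * ∫ x in Set.Ioc a (a + 2), deriv ψ x ^ 2 := by
  set E := ∫ x in Set.Ioc a (a + 2), deriv ψ x ^ 2 with hE
  have hE0 : 0 ≤ E := integral_nonneg fun x => sq_nonneg _
  have hpt : ∀ x ∈ Set.Icc (a + 1) (a + 2), ψ a ^ 2 ≤ 2 * ψ x ^ 2 + 4 * E := by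
    intro x hx
    have h1 := sq_sub_le_mul_integral_deriv_sq ψ (x := a) (y := x) (by linarith [hx.1])
    have h2 : ∫ t in a..x, deriv ψ t ^ 2 ≤ E := by
      rw [intervalIntegral.integral_of_le (by linarith [hx.1])]
      exact setIntegral_mono_set ψ.integrable_deriv_sq.integrableOn
        (Filter.Eventually.of_forall fun x => sq_nonneg _)
        (Set.Ioc_subset_Ioc_right hx.2).eventuallyLE
    have h3 : (x - a) * ∫ t in a..x, deriv ψ t ^ 2 ≤ 2 * E :=
      mul_le_mul (by linarith [hx.2]) h2 (intervalIntegral.integral_nonneg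
        (by linarith [hx.1]) fun t _ => sq_nonneg _) (by norm_num)
    nlinarith [sq_nonneg (2 * ψ x - ψ a)]
  have h := intervalIntegral.integral_mono_on (μ := volume) (by linarith : a + 1 ≤ a + 2)
    (by simp) (((ψ.integrable_sq.intervalIntegrable).const_mul 2).add (by simp)) hpt
  rw [intervalIntegral.integral_add ((ψ.integrable_sq.intervalIntegrable).const_mul 2) (by simp),
    intervalIntegral.integral_const_mul, intervalIntegral.integral_const,
    intervalIntegral.integral_const, intervalIntegral.integral_of_le (by linarith)] at h
  norm_num at h
  exact h

/-- The Morawetz multiplier profile `∫₀ˢ (1 + |τ|)^(-σ) dτ`. -/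
noncomputable def morawetzProfile (σ s : ℝ) : ℝ := ∫ τ in (0 : ℝ)..s, (1 + |τ|) ^ (-σ)

theorem continuous_profile_integrand (σ : ℝ) : Continuous fun τ : ℝ => (1 + |τ|) ^ (-σ) := by
  simpa using continuous_weight continuous_id zero_le_one (-σ)

theorem continuous_morawetzProfile (σ : ℝ) : Continuous (morawetzProfile σ) :=
  intervalIntegral.continuous_primitive
    (fun _ _ => (continuous_profile_integrand σ).intervalIntegrable _ _) 0

theorem morawetzProfile_nonneg {s : ℝ} (hs : 0 ≤ s) : 0 ≤ morawetzProfile σ s :=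
  intervalIntegral.integral_nonneg hs fun τ _ => by positivity

theorem morawetzProfile_nonpos {s : ℝ} (hs : s ≤ 0) : morawetzProfile σ s ≤ 0 := by
  rw [morawetzProfile, intervalIntegral.integral_symm, neg_nonpos]
  exact intervalIntegral.integral_nonneg hs fun τ _ => by positivity

theorem abs_morawetzProfile_le (hσ : 0 ≤ σ) (s : ℝ) : |morawetzProfile σ s| ≤ |s| := by
  have h := intervalIntegral.norm_integral_le_of_norm_le_const (a := 0) (b := s) (C := 1)
    (f := fun τ : ℝ => (1 + |τ|) ^ (-σ)) fun τ _ => by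
      rw [Real.norm_of_nonneg (by positivity)]
      simpa using weight_le_one zero_le_one (by linarith : -σ ≤ 0) τ
  simpa [morawetzProfile] using h

theorem mul_rpow_le_morawetzProfile (hσ : 0 ≤ σ) {s : ℝ} (hs : 0 ≤ s) :
    s * (1 + s) ^ (-σ) ≤ morawetzProfile σ s := by
  have h := intervalIntegral.integral_mono_on (μ := volume) hs
    (f := fun _ => (1 + s) ^ (-σ)) (g := fun τ : ℝ => (1 + |τ|) ^ (-σ)) (by simp)
    ((continuous_profile_integrand σ).intervalIntegrable _ _) fun τ hτ =>
      Real.rpow_le_rpow_of_nonpos (by positivity)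
        (by rw [abs_of_nonneg hτ.1]; linarith [hτ.2]) (by linarith)
  simpa [morawetzProfile] using h

theorem integrable_multiplier_term (hσ : 0 ≤ σ) (b a : ℝ) {U : ℝ → ℝ} {K : ℝ}
    (hU : Continuous U) (hK : ∀ x, |U x| ≤ K) (ψ : SchwartzMap ℝ ℝ) :
    Integrable fun x => morawetzProfile σ (b * (x - a)) * U x * ψ x ^ 2 := by
  have hψ : Integrable fun x => ψ x := ψ.integrable
  have h1 : Integrable fun x => x * ψ x := by
    refine (integrable_norm_iff (by fun_prop)).1 ?_
    simpa using ψ.integrable_pow_mul volume 1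
  have h2 : Integrable fun x => (b * (x - a)) * ψ x :=
    ((h1.const_mul b).sub (hψ.const_mul (b * a))).congr
      (Filter.Eventually.of_forall fun x => by simp; ring)
  have hc : Continuous fun x => morawetzProfile σ (b * (x - a)) :=
    (continuous_morawetzProfile σ).comp (by fun_prop)
  have h3 : Integrable fun x => morawetzProfile σ (b * (x - a)) * ψ x := by
    refine h2.mono (hc.mul ψ.continuous).aestronglyMeasurable
      (Filter.Eventually.of_forall fun x => ?_)
    simp only [norm_mul, Real.norm_eq_abs]
    rw [← abs_mul b]
    exact mul_le_mul_of_nonneg_right (abs_morawetzProfile_le hσ _) (abs_nonneg _)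
  refine (h3.bdd_mul (c := K * SchwartzMap.seminorm ℝ 0 0 ψ) (f := fun x => U x * ψ x)
    (hU.mul ψ.continuous).aestronglyMeasurable (Filter.Eventually.of_forall fun x => ?_)).congr
      (Filter.Eventually.of_forall fun x => by simp only; ring)
  rw [norm_mul]
  exact mul_le_mul (hK x) (ψ.norm_le_seminorm ℝ x) (norm_nonneg _)
    ((abs_nonneg _).trans (hK x))

/-- Absorption of the point value at the centre by the energy and the potential term, for a
small parameter `b`. -/
theorem point_value_absorbed (hσ : 0 < σ) (hb : 0 < b) (hb1 : b ≤ 1) {ε c : ℝ}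
    (hbε : 4 * σ * b ≤ ε * 3 ^ (-σ)) (hbc : 2 * σ * b ≤ 3 ^ (-σ) * c) {a : ℝ} {U : ℝ → ℝ} {K : ℝ}
    (hU : Continuous U) (hK : ∀ x, |U x| ≤ K) (hUr : ∀ x, a ≤ x → U x ≤ 0)
    (hUl : ∀ x, x ≤ a → 0 ≤ U x) (hUc : ∀ x ∈ Set.Ioc (a + 1) (a + 2), U x ≤ -c)
    (hc : 0 ≤ c) (hε : 0 ≤ ε) (ψ : SchwartzMap ℝ ℝ) :
    σ * b ^ 2 * ψ a ^ 2 ≤ ε * b * (∫ x, (1 + b * |x - a|) ^ (-σ) * deriv ψ x ^ 2)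
      - ∫ x, morawetzProfile σ (b * (x - a)) * U x * ψ x ^ 2 := by
  have hE : 3 ^ (-σ) * (∫ x in Set.Ioc a (a + 2), deriv ψ x ^ 2)
      ≤ ∫ x, (1 + b * |x - a|) ^ (-σ) * deriv ψ x ^ 2 := by
    have hi := integrable_weight_mul hb.le (p := -σ) (by linarith) a ψ.integrable_deriv_sq
    rw [← integral_const_mul]
    refine (setIntegral_mono_on (ψ.integrable_deriv_sq.const_mul _).integrableOn hi.integrableOn
      measurableSet_Ioc fun x hx => ?_).trans
      (setIntegral_le_integral hi (Filter.Eventually.of_forall fun x => by positivity))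
    refine mul_le_mul_of_nonneg_right (Real.rpow_le_rpow_of_nonpos (by positivity) ?_
      (by linarith)) (sq_nonneg _)
    rw [abs_of_nonneg (by linarith [hx.1])]
    nlinarith [hx.1, hx.2]
  have hP : b * 3 ^ (-σ) * c * (∫ x in Set.Ioc (a + 1) (a + 2), ψ x ^ 2)
      ≤ -∫ x, morawetzProfile σ (b * (x - a)) * U x * ψ x ^ 2 := by
    have hi := (integrable_multiplier_term hσ.le b a hU hK ψ).neg
    rw [← integral_const_mul, ← integral_neg]
    refine (setIntegral_mono_on (ψ.integrable_sq.const_mul _).integrableOn hi.integrableOn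
      measurableSet_Ioc fun x hx => ?_).trans
      (setIntegral_le_integral hi (Filter.Eventually.of_forall fun x => ?_))
    · have hs : b ≤ b * (x - a) := by nlinarith [hx.1]
      have hs3 : 1 + b * (x - a) ≤ 3 := by nlinarith [hx.1, hx.2]
      have h1 : b * 3 ^ (-σ) ≤ morawetzProfile σ (b * (x - a)) :=
        (mul_le_mul hs (Real.rpow_le_rpow_of_nonpos (by linarith) hs3 (by linarith))
          (by positivity) (by linarith)).trans
          (mul_rpow_le_morawetzProfile hσ.le (by linarith))
      have h2 := mul_le_mul h1 (show c ≤ -U x by linarith [hUc x hx]) hc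
        ((by positivity : 0 ≤ b * 3 ^ (-σ)).trans h1)
      have h3 := mul_le_mul_of_nonneg_right h2 (sq_nonneg (ψ x))
      simp only [Pi.neg_apply]
      linarith
    · have : morawetzProfile σ (b * (x - a)) * U x ≤ 0 := by
        rcases le_total a x with h | h
        · exact mul_nonpos_of_nonneg_of_nonpos
            (morawetzProfile_nonneg (mul_nonneg hb.le (by linarith))) (hUr x h)
        · exact mul_nonpos_of_nonpos_of_nonneg
            (morawetzProfile_nonpos (mul_nonpos_of_nonneg_of_nonpos hb.le (by linarith)))
            (hUl x h)
      have := mul_nonpos_of_nonpos_of_nonneg this (sq_nonneg (ψ x))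
      simp only [Pi.neg_apply, Pi.zero_apply]
      linarith
  have hloc := mul_le_mul_of_nonneg_left (sq_apply_le_local ψ a)
    (by positivity : 0 ≤ σ * b ^ 2)
  have hE0 : 0 ≤ ∫ x in Set.Ioc a (a + 2), deriv ψ x ^ 2 := integral_nonneg fun x => sq_nonneg _
  have hP0 : 0 ≤ ∫ x in Set.Ioc (a + 1) (a + 2), ψ x ^ 2 := integral_nonneg fun x => sq_nonneg _
  have h1 := mul_le_mul_of_nonneg_right hbε (mul_nonneg hb.le hE0)
  have h2 := mul_le_mul_of_nonneg_right hbc (mul_nonneg hb.le hP0)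
  have h3 := mul_le_mul_of_nonneg_left hE (mul_nonneg hε hb.le)
  linarith

theorem rpow_neg_ge_japanese {t K x p : ℝ} (hp : 0 ≤ p) (ht : 0 < t) (hK : 0 < K)
    (h : t ≤ K * Real.sqrt (1 + x ^ 2)) :
    K ^ (-p) * ((1 + x ^ 2) ^ (p / 2))⁻¹ ≤ t ^ (-p) := by
  have hx : 0 ≤ 1 + x ^ 2 := by positivity
  refine le_trans (le_of_eq ?_) (Real.rpow_le_rpow_of_nonpos ht h (by linarith))
  rw [Real.mul_rpow hK.le (Real.sqrt_nonneg _), Real.sqrt_eq_rpow, ← Real.rpow_mul hx,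
    ← Real.rpow_neg hx]
  congr 2
  ring

theorem one_add_mul_abs_sub_le {X a : ℝ} (hb1 : b ≤ 1) (ha : |a| ≤ X) (x : ℝ) :
    1 + b * |x - a| ≤ (2 + X) * Real.sqrt (1 + x ^ 2) := by
  have h1 : 1 ≤ Real.sqrt (1 + x ^ 2) := Real.one_le_sqrt.2 (by nlinarith [sq_nonneg x])
  have h2 : |x| ≤ Real.sqrt (1 + x ^ 2) := Real.abs_le_sqrt (by linarith)
  have h3 : |x - a| ≤ |x| + X := (abs_sub x a).trans (by linarith)
  have h4 : b * |x - a| ≤ |x - a| := mul_le_of_le_one_left (abs_nonneg _) hb1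
  nlinarith [abs_nonneg a]

/-- The Morawetz commutator estimate for a family of potentials, with derivatives `U`, that
increase up to a centre `a` in a bounded region and decrease afterwards, quantitatively on
`[a + 1, a + 2]`. -/
theorem exists_morawetz_constants (hσ : 0 < σ) {X c : ℝ} (hX : 0 ≤ X) (hc : 0 < c) :
    ∃ b : ℝ, 0 < b ∧ ∃ C : ℝ, 0 < C ∧ ∀ a : ℝ, |a| ≤ X → ∀ U : ℝ → ℝ, Continuous U →
      (∃ K, ∀ x, |U x| ≤ K) → (∀ x, a ≤ x → U x ≤ 0) → (∀ x, x ≤ a → 0 ≤ U x) →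
      (∀ x ∈ Set.Ioc (a + 1) (a + 2), U x ≤ -c) → ∀ ψ : SchwartzMap ℝ ℝ,
      C * ∫ x : ℝ, ((ψ x) ^ 2 / (1 + x ^ 2) ^ (σ / 2 + 1)
          + (deriv ψ x) ^ 2 / (1 + x ^ 2) ^ (σ / 2))
        ≤ (∫ x : ℝ, 2 * (b * (1 + b * |x - a|) ^ (-σ)) * (deriv ψ x) ^ 2)
          + σ * b ^ 2 * (ψ a) ^ 2
          - (1 / 2) * (∫ x : ℝ,
              b ^ 3 * σ * (σ + 1) / (1 + b * |x - a|) ^ (σ + 2) * (ψ x) ^ 2)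
          - ∫ x : ℝ, morawetzProfile σ (b * (x - a)) * U x * (ψ x) ^ 2 := by
  set ε : ℝ := 1 / (2 * (σ + 2)) with hε
  have hε0 : 0 < ε := by positivity
  have h3 : (0 : ℝ) < 3 ^ (-σ) := by positivity
  obtain ⟨b, hb, hb1, hbε, hbc⟩ : ∃ b : ℝ, 0 < b ∧ b ≤ 1 ∧ 4 * σ * b ≤ ε * 3 ^ (-σ) ∧
      2 * σ * b ≤ 3 ^ (-σ) * c := by
    refine ⟨min 1 (min (ε * 3 ^ (-σ) / (4 * σ)) (3 ^ (-σ) * c / (2 * σ))), by positivity,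
      min_le_left _ _, ?_, ?_⟩
    · rw [← le_div_iff₀' (by positivity)]
      exact (min_le_right _ _).trans (min_le_left _ _)
    · rw [← le_div_iff₀' (by positivity)]
      exact (min_le_right _ _).trans (min_le_right _ _)
  have hK : 0 < 2 + X := by linarith
  refine ⟨b, hb, min (ε * b * (2 + X) ^ (-σ)) (b ^ 3 * σ / 4 * (2 + X) ^ (-(σ + 2))),
    by positivity, fun a ha U hU ⟨K, hUK⟩ hUr hUl hUc ψ => ?_⟩
  have i1 := integrable_weight_mul hb.le (p := -(σ + 2)) (by linarith) a ψ.integrable_sq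
  have i2 := integrable_weight_mul hb.le (p := -σ) (by linarith) a ψ.integrable_deriv_sq
  have hpt := point_value_absorbed hσ hb hb1 hbε hbc hU hUK hUr hUl hUc hc.le hε0.le ψ
  have hhardy := hardy_line hσ.le hb a ψ
  have e1 : (∫ x : ℝ, 2 * (b * (1 + b * |x - a|) ^ (-σ)) * (deriv ψ x) ^ 2)
      = 2 * b * ∫ x, (1 + b * |x - a|) ^ (-σ) * deriv ψ x ^ 2 := by
    rw [← integral_const_mul]
    congr 1 with x
    ring
  have e2 : (∫ x : ℝ, b ^ 3 * σ * (σ + 1) / (1 + b * |x - a|) ^ (σ + 2) * (ψ x) ^ 2)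
      = b ^ 3 * σ * (σ + 1) * ∫ x, (1 + b * |x - a|) ^ (-(σ + 2)) * ψ x ^ 2 := by
    rw [← integral_const_mul]
    congr 1 with x
    rw [Real.rpow_neg (by positivity), div_eq_mul_inv]
    ring
  set C := min (ε * b * (2 + X) ^ (-σ)) (b ^ 3 * σ / 4 * (2 + X) ^ (-(σ + 2))) with hC
  have hC0 : 0 ≤ C := by positivity
  have hR : C * ∫ x : ℝ, ((ψ x) ^ 2 / (1 + x ^ 2) ^ (σ / 2 + 1)
        + (deriv ψ x) ^ 2 / (1 + x ^ 2) ^ (σ / 2))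
      ≤ b ^ 3 * σ / 4 * (∫ x, (1 + b * |x - a|) ^ (-(σ + 2)) * ψ x ^ 2)
        + ε * b * ∫ x, (1 + b * |x - a|) ^ (-σ) * deriv ψ x ^ 2 := by
    rw [← integral_const_mul, ← integral_const_mul, ← integral_const_mul,
      ← integral_add (i1.const_mul _) (i2.const_mul _)]
    refine integral_mono_of_nonneg (Filter.Eventually.of_forall fun x => by
      simp only [Pi.zero_apply]; positivity)
      ((i1.const_mul _).add (i2.const_mul _)) (Filter.Eventually.of_forall fun x => ?_)
    have ht : 0 < 1 + b * |x - a| := by positivity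
    have hle := one_add_mul_abs_sub_le hb1 ha x
    have h1 := rpow_neg_ge_japanese (by linarith : 0 ≤ σ + 2) ht hK hle
    have h2 := rpow_neg_ge_japanese hσ.le ht hK hle
    rw [show (σ + 2) / 2 = σ / 2 + 1 by ring] at h1
    have j1 : C * ((1 + x ^ 2) ^ (σ / 2 + 1))⁻¹ ≤ b ^ 3 * σ / 4 * (1 + b * |x - a|) ^ (-(σ + 2)) :=
      (mul_le_mul_of_nonneg_right (min_le_right _ _) (by positivity)).trans (by
        rw [mul_assoc]; exact mul_le_mul_of_nonneg_left h1 (by positivity))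
    have j2 : C * ((1 + x ^ 2) ^ (σ / 2))⁻¹ ≤ ε * b * (1 + b * |x - a|) ^ (-σ) :=
      (mul_le_mul_of_nonneg_right (min_le_left _ _) (by positivity)).trans (by
        rw [mul_assoc]; exact mul_le_mul_of_nonneg_left h2 (by positivity))
    have k1 := mul_le_mul_of_nonneg_right j1 (sq_nonneg (ψ x))
    have k2 := mul_le_mul_of_nonneg_right j2 (sq_nonneg (deriv ψ x))
    simp only [div_eq_mul_inv] at k1 k2 ⊢
    linarith
  rw [e1, e2]
  set Z := ∫ x, (1 + b * |x - a|) ^ (-(σ + 2)) * ψ x ^ 2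
  set E := ∫ x, (1 + b * |x - a|) ^ (-σ) * deriv ψ x ^ 2
  have hε1 : ε * (σ + 2) = 1 / 2 := by rw [hε]; field_simp
  have hε2 : ε ≤ 1 := by nlinarith
  have hh := mul_le_mul_of_nonneg_left hhardy (by linarith : 0 ≤ 2 * (1 - ε))
  have hcoef : 2 * (1 - ε) * (b ^ 3 * (σ * (σ + 2) / 4) * Z)
      = b ^ 3 * σ * (σ + 1) / 2 * Z + b ^ 3 * σ / 4 * Z := by
    linear_combination -(b ^ 3 * σ / 2 * Z) * hε1
  have hpos : 0 ≤ ε * (σ * b ^ 2 * ψ a ^ 2) := by positivity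
  linarith

end Weights

/-- The derivative of the effective potential with critical radius `a` with respect to the
tortoise coordinate, as a function of the radius. -/
noncomputable def potentialSlope (M L a r : ℝ) : ℝ :=
  -(2 / r ^ 5) * ((r - a) * (L * r + 8 * M ^ 2 / a)) * (1 - 2 * M / r)

theorem potentialSlope_eq_neg_mul (M L a r : ℝ) :
    potentialSlope M L a r
      = -((r - a) * (2 / r ^ 5 * (L * r + 8 * M ^ 2 / a) * (1 - 2 * M / r))) := by
  unfold potentialSlope
  ring

theorem potentialSlope_factor_nonneg {M L a r : ℝ} (hM : 0 < M) (hL : 0 ≤ L) (ha : 0 < a)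
    (hr : 2 * M < r) : 0 ≤ 2 / r ^ 5 * (L * r + 8 * M ^ 2 / a) * (1 - 2 * M / r) := by
  have hr0 : 0 < r := by linarith
  have : 0 < 1 - 2 * M / r := by rw [one_sub_div hr0.ne']; exact div_pos (by linarith) hr0
  positivity

theorem abs_potentialSlope_le {M L a r : ℝ} (hM : 0 < M) (hL : 0 ≤ L) (ha : 0 < a)
    (ha3 : a ≤ 3 * M) (hr : 2 * M < r) :
    |potentialSlope M L a r| ≤ 4 * (L + 4 * M / a) / (2 * M) ^ 3 := by
  have hr0 : 0 < r := by linarith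
  have h1 : |r - a| ≤ 2 * r := abs_le.2 ⟨by linarith, by linarith⟩
  have h2 : 1 - 2 * M / r ≤ 1 := by
    have : 0 ≤ 2 * M / r := by positivity
    linarith
  have h2' : 0 ≤ 1 - 2 * M / r := by
    rw [one_sub_div hr0.ne']; exact div_nonneg (by linarith) hr0.le
  have h3 : L * r + 8 * M ^ 2 / a ≤ (L + 4 * M / a) * r := by
    have : 8 * M ^ 2 / a = 4 * M / a * (2 * M) := by ring
    have : 4 * M / a * (2 * M) ≤ 4 * M / a * r := by gcongr
    linarith
  rw [potentialSlope_eq_neg_mul, abs_neg, abs_mul,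
    abs_of_nonneg (potentialSlope_factor_nonneg hM hL ha hr)]
  calc |r - a| * (2 / r ^ 5 * (L * r + 8 * M ^ 2 / a) * (1 - 2 * M / r))
      ≤ 2 * r * (2 / r ^ 5 * ((L + 4 * M / a) * r) * 1) := by gcongr
    _ = 4 * (L + 4 * M / a) / r ^ 3 := by field_simp; ring
    _ ≤ _ := by gcongr

theorem potentialSlope_le {M L a r : ℝ} (hM : 0 < M) (hL : 0 ≤ L) (ha : 8 * M / 3 ≤ a)
    (ha3 : a ≤ 3 * M) (hr : a + 1 / 4 ≤ r) (hr2 : r ≤ 3 * M + 2) :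
    potentialSlope M L a r ≤ -(1 / 4 * (2 / (3 * M + 2) ^ 5 * (8 * M / 3) * (1 / 4))) := by
  have hr0 : 0 < r := by linarith
  have ha0 : 0 < a := by linarith
  have h1 : 1 / 4 ≤ r - a := by linarith
  have h2 : 1 / 4 ≤ 1 - 2 * M / r := by
    rw [one_sub_div hr0.ne', le_div_iff₀ hr0]
    linarith
  have h3 : 8 * M / 3 ≤ L * r + 8 * M ^ 2 / a := by
    have h4 : 8 * M / 3 ≤ 8 * M ^ 2 / a := by
      rw [le_div_iff₀ ha0]
      nlinarith
    have := mul_nonneg hL hr0.le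
    linarith
  rw [potentialSlope_eq_neg_mul, neg_le_neg_iff]
  gcongr

theorem tortoise_critical_bound {M a : ℝ} (hM : 0 < M) (ha : 8 * M / 3 ≤ a) (ha3 : a ≤ 3 * M) :
    |tortoise M a| ≤ |tortoise M (8 * M / 3)| + |tortoise M (3 * M)| := by
  have h1 := sub_le_tortoise_sub hM (by linarith : 2 * M < 8 * M / 3) ha
  have h2 := sub_le_tortoise_sub hM (by linarith : 2 * M < a) ha3
  rw [abs_le]
  constructor
  · linarith [neg_abs_le (tortoise M (8 * M / 3)), abs_nonneg (tortoise M (3 * M))]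
  · linarith [le_abs_self (tortoise M (3 * M)), abs_nonneg (tortoise M (8 * M / 3))]

/-- Fix `M > 0` and `σ > 1`.  Then there exist `b > 0` and
`C > 0` such that for every `l ∈ ℕ` (with `λ = l(l+1)`) and every Schwartz
function `ψ : ℝ → ℝ` the Morawetz commutator estimate
`∫ 2 g_λ'(x) ψ'(x)² dx + σ b² ψ(x_λ)²`
`− (1/2)∫ (b³ σ(σ+1)/(1 + b|x − x_λ|)^{σ+2}) ψ(x)² dx − ∫ g_λ(x)·W_λ'(x)·ψ(x)² dx`
`≥ C·∫ (ψ(x)²/(1 + x²)^{σ/2 + 1} + ψ'(x)²/(1 + x²)^{σ/2}) dx`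
holds, with `b, C` uniform in `l`.  Here `x_λ = r_*(α_λ)`, `α_λ` is the unique
critical point of `V_λ` in `(2M, ∞)`, `W_λ(x) = V_λ(ρ(x))` with `ρ` the inverse of
the tortoise coordinate `r_*`, and
`g_λ(x) = ∫_0^{b(x − x_λ)} (1 + |τ|)^{−σ} dτ`, so
`g_λ'(x) = b(1 + b|x − x_λ|)^{−σ}`. -/
theorem morawetz_commutator_estimate_uniform (M : ℝ) (hM : 0 < M) (σ : ℝ) (hσ : 1 < σ)
    (rstar : ℝ → ℝ)
    (hrstar : ∀ r : ℝ, rstar r =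
      r + 2 * M * Real.log ((r - 2 * M) / (2 * M)) - 3 * M + 2 * M * Real.log 2)
    (ρ : ℝ → ℝ) (hρ1 : ∀ x : ℝ, ρ x ∈ Set.Ioi (2 * M))
    (hρ2 : ∀ x : ℝ, rstar (ρ x) = x)
    (V : ℝ → ℝ → ℝ)
    (hV : ∀ lam r : ℝ, V lam r = (1 - 2 * M / r) * (2 * M / r ^ 3 + lam / r ^ 2))
    (alpha : ℕ → ℝ)
    (halpha : ∀ l : ℕ, alpha l ∈ Set.Ioi (2 * M) ∧
      (∀ r ∈ Set.Ioi (2 * M),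
        deriv (V ((l : ℝ) * ((l : ℝ) + 1))) r = 0 ↔ r = alpha l)) :
    ∃ b : ℝ, 0 < b ∧ ∃ C : ℝ, 0 < C ∧ ∀ l : ℕ, ∀ ψ : SchwartzMap ℝ ℝ,
      (∫ x : ℝ, 2 * (b * (1 + b * |x - rstar (alpha l)|) ^ (-σ)) * (deriv ψ x) ^ 2)
        + σ * b ^ 2 * (ψ (rstar (alpha l))) ^ 2
        - (1 / 2) * (∫ x : ℝ,
            b ^ 3 * σ * (σ + 1) / (1 + b * |x - rstar (alpha l)|) ^ (σ + 2) * (ψ x) ^ 2)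
        - (∫ x : ℝ,
            (∫ τ in (0 : ℝ)..(b * (x - rstar (alpha l))), (1 + |τ|) ^ (-σ))
              * deriv (fun y : ℝ => V ((l : ℝ) * ((l : ℝ) + 1)) (ρ y)) x * (ψ x) ^ 2)
      ≥ C * ∫ x : ℝ,
          ((ψ x) ^ 2 / (1 + x ^ 2) ^ (σ / 2 + 1)
            + (deriv ψ x) ^ 2 / (1 + x ^ 2) ^ (σ / 2)) := by
  obtain rfl : rstar = tortoise M := funext hrstar
  have hσ0 : 0 < σ := by linarith
  have hρ : ∀ x, 2 * M < ρ x := hρ1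
  have hcrit : ∀ l : ℕ, ((l : ℝ) * (l + 1)) * alpha l ^ 2
      - 3 * M * ((l : ℝ) * (l + 1) - 1) * alpha l - 8 * M ^ 2 = 0 := by
    intro l
    have ha : 2 * M < alpha l := (halpha l).1
    have ha0 : 0 < alpha l := by linarith
    have h := ((halpha l).2 (alpha l) ha).2 rfl
    rw [funext (hV _), (regge_wheeler_hasDerivAt M _ _ ha0).deriv] at h
    exact (mul_eq_zero.1 h).resolve_left (neg_ne_zero.2 (by positivity))
  obtain ⟨b, hb, C, hC, hmain⟩ := exists_morawetz_constants hσ0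
    (X := |tortoise M (8 * M / 3)| + |tortoise M (3 * M)|)
    (c := 1 / 4 * (2 / (3 * M + 2) ^ 5 * (8 * M / 3) * (1 / 4))) (by positivity) (by positivity)
  refine ⟨b, hb, C, hC, fun l ψ => ?_⟩
  have hL : (0 : ℝ) ≤ (l : ℝ) * (l + 1) := by positivity
  have hQ := hcrit l
  have ha2 : 2 * M < alpha l := (halpha l).1
  set L : ℝ := (l : ℝ) * (l + 1)
  set a := alpha l
  obtain ⟨ha, ha3⟩ := critical_radius_bounds hM hL ha2 hQ
  have ha0 : 0 < a := by linarith
  have hderiv : deriv (fun y => V L (ρ y)) = fun x => potentialSlope M L a (ρ x) := by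
    funext x
    simp only [hV]
    exact (hasDerivAt_effective_potential hM hρ hρ2 ha0.ne' hQ x).deriv
  have hρc : Continuous ρ := (lipschitz_of_tortoise_inverse hM hρ hρ2).continuous
  have hcont : Continuous fun x => potentialSlope M L a (ρ x) := by
    have hne : ∀ x, ρ x ≠ 0 := fun x => by linarith [hρ x]
    unfold potentialSlope
    fun_prop (disch := simp [hne])
  rw [hderiv]
  refine hmain (tortoise M a) (tortoise_critical_bound hM ha ha3) _ hcont
    ⟨_, fun x => abs_potentialSlope_le hM hL ha0 ha3 (hρ x)⟩ (fun x hx => ?_) (fun x hx => ?_)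
    (fun x hx => ?_) ψ
  · rw [potentialSlope_eq_neg_mul, neg_nonpos]
    exact mul_nonneg (by linarith [le_of_tortoise_le hM hρ hρ2 hx])
      (potentialSlope_factor_nonneg hM hL ha0 (hρ x))
  · rw [potentialSlope_eq_neg_mul, neg_nonneg]
    exact mul_nonpos_of_nonpos_of_nonneg (by linarith [le_of_le_tortoise hM hρ2 ha2 hx])
      (potentialSlope_factor_nonneg hM hL ha0 (hρ x))
  · have har := le_of_tortoise_le hM hρ hρ2 (a := a) (x := x) (by linarith [hx.1])
    have h1 := tortoise_sub_le hM ha har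
    have h2 := sub_le_tortoise_sub hM ha2 har
    rw [hρ2] at h1 h2
    exact potentialSlope_le hM hL ha ha3 (by linarith [hx.1]) (by linarith [hx.2])
end
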